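/- Let A be a finite-dimensional symmetric algebra over a field k and let P, Q be bounded complexes of finitely generated projective A-modules. Then for every integer n there is a k-linear isomorphism Hom_{K^b(proj A)}(P, Q[n]) ≅ D Hom_{K^b(proj A)}(Q, P[-n]), where D = Hom_k(-,k). -/

import Mathlib

open CategoryTheory Limits

universe u

section LinearAlgebra

variable {k X Y Z X' Y' Z' H H' : Type*} [Field k]
  [AddCommGroup H] [Module k H] [AddCommGroup H'] [Module k H']
  [AddCommGroup X] [Module k X] [AddCommGroup Y] [Module k Y]
  [AddCommGroup X'] [Module k X'] [AddCommGroup Y'] [Module k Y'] [AddCommGroup Z'] [Module k Z']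
  [AddCommGroup Z] [Module k Z]

/-- Two three-term complexes which are in duality up to nonzero scalars, with a perfect pairing of
the middle terms, have dual middle cohomologies. -/
lemma nonempty_cohomology_equiv_dual
    (d₁ : X →ₗ[k] Y) (d₂ : Y →ₗ[k] Z) (e₂ : Z' →ₗ[k] Y') (e₁ : Y' →ₗ[k] X')
    (he : ∀ z, e₁ (e₂ z) = 0)
    (BX : X →ₗ[k] X' →ₗ[k] k) (BY : Y →ₗ[k] Y' →ₗ[k] k) (BZ : Z →ₗ[k] Z' →ₗ[k] k)
    [BY.IsPerfPair] {c₁ c₂ : k} (hc₁ : c₁ ≠ 0) (hc₂ : c₂ ≠ 0)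
    (h₁ : ∀ x y', BY (d₁ x) y' = c₁ * BX x (e₁ y'))
    (h₂ : ∀ y z', BZ (d₂ y) z' = c₂ * BY y (e₂ z'))
    (hX : ∀ x', (∀ x, BX x x' = 0) → x' = 0) (hZ : ∀ z, (∀ z', BZ z z' = 0) → z = 0)
    (π : LinearMap.ker d₂ →ₗ[k] H) (hπ : Function.Surjective π)
    (hπ₀ : ∀ y, π y = 0 ↔ y.1 ∈ LinearMap.range d₁)
    (π' : LinearMap.ker e₁ →ₗ[k] H') (hπ' : Function.Surjective π')
    (hπ'₀ : ∀ y, π' y = 0 ↔ y.1 ∈ LinearMap.range e₂) :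
    Nonempty (H ≃ₗ[k] Module.Dual k H') := by
  let ψ : LinearMap.ker d₂ →ₗ[k] Module.Dual k (LinearMap.ker e₁) :=
    BY.domRestrict₁₂ (LinearMap.ker d₂) (LinearMap.ker e₁)
  have hψ (y : LinearMap.ker d₂) (y' : LinearMap.ker e₁) : ψ y y' = BY y.1 y'.1 := rfl
  have hker : LinearMap.ker π = LinearMap.ker ψ := by
    ext y
    rw [LinearMap.mem_ker, hπ₀, LinearMap.mem_ker]
    constructor
    · rintro ⟨x, hx⟩
      ext y'
      rw [hψ, ← hx, h₁, LinearMap.mem_ker.mp y'.2]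
      simp
    · intro hy
      by_contra hy₁
      obtain ⟨l, hl, hl₁⟩ := Submodule.exists_le_ker_of_notMem hy₁
      obtain ⟨y', rfl⟩ := (LinearMap.IsPerfPair.bijective_right BY).2 l
      have hy' : e₁ y' = 0 := hX _ fun x ↦ by
        have := hl₁ (LinearMap.mem_range_self d₁ x)
        rw [LinearMap.mem_ker, LinearMap.flip_apply, h₁] at this
        exact (mul_eq_zero.mp this).resolve_left hc₁
      exact hl (by simpa using! congr($hy ⟨y', hy'⟩))
  have hrange : LinearMap.range ψ = LinearMap.range π'.dualMap := by
    rw [LinearMap.range_dualMap_eq_dualAnnihilator_ker]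
    ext l
    rw [Submodule.mem_dualAnnihilator]
    constructor
    · rintro ⟨y, rfl⟩ y' hy'
      obtain ⟨z', hz'⟩ := (hπ'₀ y').mp hy'
      have := h₂ y.1 z'
      rw [LinearMap.mem_ker.mp y.2, map_zero, LinearMap.zero_apply] at this
      rw [hψ, ← hz']
      exact (mul_eq_zero.mp this.symm).resolve_left hc₂
    · intro hl
      obtain ⟨l', hl'⟩ := LinearMap.exists_extend l
      obtain ⟨y, rfl⟩ := (LinearMap.IsPerfPair.bijective_left BY).2 l'
      refine ⟨⟨y, hZ _ fun z' ↦ ?_⟩, hl'⟩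
      have := hl ⟨e₂ z', he z'⟩ ((hπ'₀ _).mpr ⟨z', rfl⟩)
      rw [← hl'] at this
      rw [h₂]
      exact mul_eq_zero_of_right _ this
  exact ⟨(π.quotKerEquivOfSurjective hπ).symm ≪≫ₗ Submodule.quotEquivOfEq _ _ hker ≪≫ₗ
    ψ.quotKerEquivRange ≪≫ₗ LinearEquiv.ofEq _ _ hrange ≪≫ₗ
    (LinearEquiv.ofInjective π'.dualMap (LinearMap.dualMap_injective_of_surjective hπ')).symm⟩

end LinearAlgebra

namespace CochainComplex.HomComplex

variable {k : Type*} [Field k] {C : Type*} [Category* C] [Preadditive C] [Linear k C]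

/-- Morphisms `K ⟶ L⟦n⟧` in the homotopy category are the cohomology classes of degree `n`,
`k`-linearly. -/
lemma exists_linear_cocycles_to_homotopyCategory [HasZeroObject C] [HasBinaryBiproducts C]
    (K L : CochainComplex C ℤ) (m n p : ℤ)
    (hm : m + 1 = n) (hp : n + 1 = p) :
    ∃ π : LinearMap.ker (δ_hom k K L n p) →ₗ[k]
      ((HomotopyCategory.quotient C (ComplexShape.up ℤ)).obj K ⟶
        ((HomotopyCategory.quotient C (ComplexShape.up ℤ)).obj L)⟦n⟧),
      Function.Surjective π ∧ ∀ z, π z = 0 ↔ z.1 ∈ LinearMap.range (δ_hom k K L m n) := by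
  let F := HomotopyCategory.quotient C (ComplexShape.up ℤ)
  let e := Linear.homCongr k (Iso.refl (F.obj K)) ((F.commShiftIso n).app L)
  let c (z : LinearMap.ker (δ_hom k K L n p)) : Cocycle K L n := Cocycle.mk z.1 p hp z.2
  let f : LinearMap.ker (δ_hom k K L n p) →ₗ[k] (F.obj K ⟶ F.obj (L⟦n⟧)) :=
    { toFun z := CohomologyClass.toHom (.mk (c z))
      map_add' x y := by
        rw [← map_add, ← CohomologyClass.mk_add]
        rfl
      map_smul' r x := by
        rw [CohomologyClass.toHom_mk, CohomologyClass.toHom_mk, RingHom.id_apply,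
          ← Functor.map_smul]
        congr 1
        ext i
        simp [c, Cocycle.equivHomShift_symm_apply]
        rfl }
  have hf : Function.Surjective f := fun g ↦ by
    obtain ⟨x, rfl⟩ := (CohomologyClass.toHom_bijective K L n).2 g
    obtain ⟨x, rfl⟩ := x.mk_surjective
    exact ⟨⟨x.1, x.δ_eq_zero p⟩, rfl⟩
  refine ⟨e.toLinearMap ∘ₗ f, e.surjective.comp hf, fun z ↦ ?_⟩
  rw [LinearMap.comp_apply, LinearEquiv.coe_coe, LinearEquiv.map_eq_zero_iff]
  exact (CohomologyClass.toHom_mk_eq_zero_iff (c z)).trans (mem_coboundaries_iff _ m hm)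

section Pairing

variable {P Q : CochainComplex C ℤ} (τ : ∀ i, (P.X i ⟶ P.X i) →ₗ[k] k) (S : Finset ℤ)

/-- The alternating sum over `S` of the values of `τ` on the components of an endomorphism
of degree zero. -/
def superTrace : Cochain P P 0 →ₗ[k] k where
  toFun z := ∑ i ∈ S, ((i.negOnePow : ℤ) : k) * τ i (z.v i i (add_zero i))
  map_add' x y := by simp [mul_add, Finset.sum_add_distrib]
  map_smul' r x := by
    simp only [Cochain.smul_v, map_smul, smul_eq_mul, RingHom.id_apply, Finset.mul_sum]
    exact Finset.sum_congr rfl fun _ _ ↦ by ring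

/-- The supertrace pairing between cochains of degrees `n` and `m` with `n + m = 0`. -/
def tracePairing {n m : ℤ} (h : n + m = 0) : Cochain P Q n →ₗ[k] Cochain Q P m →ₗ[k] k :=
  LinearMap.mk₂ k (fun x y ↦ superTrace τ S (x.comp y h))
    (by simp) (by simp) (by simp) (by simp)

lemma tracePairing_apply {n m : ℤ} (h : n + m = 0) (x : Cochain P Q n) (y : Cochain Q P m) :
    tracePairing τ S h x y =
      ∑ i ∈ S, ((i.negOnePow : ℤ) : k) * τ i ((x.comp y h).v i i (add_zero i)) := rfl

lemma superTrace_δ {a b : ℤ}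
    (hτ : ∀ i j (f : P.X i ⟶ P.X j) (g : P.X j ⟶ P.X i), τ i (f ≫ g) = τ j (g ≫ f))
    (hP : ∀ i, (i < a ∨ b < i) → IsZero (P.X i)) (z : Cochain P P (-1)) :
    superTrace τ (Finset.Icc a b) (δ (-1) 0 z) = 0 := by
  let F (i : ℤ) : k := ((i.negOnePow : ℤ) : k) *
    τ i (P.d i (i + 1) ≫ z.v (i + 1) i (by lia))
  have hF (i : ℤ) (hi : F i ≠ 0) : a ≤ i ∧ i + 1 ≤ b := by
    by_contra h
    obtain h | h : (i < a ∨ b < i + 1) := by lia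
    · exact hi (by simp [F, (hP i (.inl h)).eq_of_src (P.d i (i + 1)) 0])
    · exact hi (by simp [F, (hP (i + 1) (.inr h)).eq_of_tgt (P.d i (i + 1)) 0])
  have key (i : ℤ) : ((i.negOnePow : ℤ) : k) * τ i ((δ (-1) 0 z).v i i (add_zero i)) =
      F i - F (i - 1) := by
    obtain ⟨j, rfl⟩ : ∃ j, i = j + 1 := ⟨i - 1, by simp⟩
    rw [δ_v (-1) 0 (by simp) z _ _ (add_zero _) j (j + 1 + 1) (by simp) rfl,
      congrArg F (add_sub_cancel_right j 1), map_add, ← hτ j (j + 1)]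
    simp only [F, Int.negOnePow_zero, one_smul, Int.negOnePow_succ, Units.val_neg, Int.cast_neg]
    ring
  change ∑ i ∈ Finset.Icc a b, _ = 0
  rw [Finset.sum_congr rfl fun i _ ↦ key i, Finset.sum_sub_distrib, sub_eq_zero,
    ← finsum_eq_sum_of_support_subset F (fun i hi ↦ by
      have := hF i hi
      simp only [Finset.coe_Icc, Set.mem_Icc]
      lia),
    ← finsum_eq_sum_of_support_subset (fun i ↦ F (i - 1)) (fun i hi ↦ by
      have := hF (i - 1) hi
      simp only [Finset.coe_Icc, Set.mem_Icc]
      lia)]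
  exact (finsum_comp_equiv (Equiv.subRight (1 : ℤ))).symm

lemma tracePairing_δ {a b : ℤ}
    (hτ : ∀ i j (f : P.X i ⟶ P.X j) (g : P.X j ⟶ P.X i), τ i (f ≫ g) = τ j (g ≫ f))
    (hP : ∀ i, (i < a ∨ b < i) → IsZero (P.X i)) {n n' m m' : ℤ}
    (hn : n + 1 = n') (hm : m + 1 = m') (h : n' + m = 0) (h' : n + m' = 0)
    (x : Cochain P Q n) (y : Cochain Q P m) :
    tracePairing τ (Finset.Icc a b) h (δ n n' x) y =
      -((m.negOnePow : ℤ) : k) * tracePairing τ (Finset.Icc a b) h' x (δ m m' y) := by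
  have := superTrace_δ τ hτ hP (x.comp y (show n + m = -1 by lia))
  rw [δ_comp x y _ n' m' 0 (by simp) hn hm, map_add, Units.smul_def, map_zsmul] at this
  change tracePairing τ (Finset.Icc a b) h' x (δ m m' y) +
    (m.negOnePow : ℤ) • tracePairing τ (Finset.Icc a b) h (δ n n' x) y = 0 at this
  rcases Int.even_or_odd m with hm | hm
  · simp only [Int.negOnePow_even _ hm, Units.val_one, one_smul] at this
    simp only [Int.negOnePow_even _ hm, Units.val_one, Int.cast_one]
    linear_combination this
  · simp only [Int.negOnePow_odd _ hm, Units.val_neg, Units.val_one, neg_smul, one_smul] at this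
    simp only [Int.negOnePow_odd _ hm, Units.val_neg, Units.val_one, Int.cast_neg, Int.cast_one]
    linear_combination -this

lemma tracePairing_injective {a b : ℤ}
    (hP : ∀ i, (i < a ∨ b < i) → IsZero (P.X i))
    (hl : ∀ i j (f : P.X i ⟶ Q.X j), f ≠ 0 → ∃ g, τ i (f ≫ g) ≠ 0)
    {n m : ℤ} (h : n + m = 0) (x : Cochain P Q n)
    (hx : ∀ y, tracePairing τ (Finset.Icc a b) h x y = 0) : x = 0 := by
  ext p q hpq
  by_contra hxp
  obtain ⟨g, hg⟩ := hl p q _ hxp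
  have hp : p ∈ Finset.Icc a b := by
    by_contra hp
    exact hxp ((hP p (by simp at hp; lia)).eq_of_src _ _)
  refine hg ?_
  have := hx (Cochain.single g m)
  rw [tracePairing_apply, Finset.sum_eq_single_of_mem p hp fun i _ hi ↦ ?_,
    Cochain.comp_v _ _ h p q p hpq (by lia), Cochain.single_v] at this
  · exact (mul_eq_zero.mp this).resolve_left (by
      rcases Int.even_or_odd p with hp | hp <;> simp [Int.negOnePow_even, Int.negOnePow_odd, hp])
  · rw [Cochain.comp_v _ _ h i (i + n) i rfl (by lia), Cochain.single_v_eq_zero _ _ _ _ _ (by lia)]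
    simp

lemma tracePairing_flip_injective {a b : ℤ}
    (hP : ∀ i, (i < a ∨ b < i) → IsZero (P.X i))
    (hr : ∀ i j (g : Q.X j ⟶ P.X i), g ≠ 0 → ∃ f, τ i (f ≫ g) ≠ 0)
    {n m : ℤ} (h : n + m = 0) (y : Cochain Q P m)
    (hy : ∀ x, tracePairing τ (Finset.Icc a b) h x y = 0) : y = 0 := by
  ext q p hqp
  by_contra hyp
  obtain ⟨f, hf⟩ := hr p q _ hyp
  have hp : p ∈ Finset.Icc a b := by
    by_contra hp
    exact hyp ((hP p (by simp at hp; lia)).eq_of_tgt _ _)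
  refine hf ?_
  have := hy (Cochain.single f n)
  rw [tracePairing_apply, Finset.sum_eq_single_of_mem p hp fun i _ hi ↦ ?_,
    Cochain.comp_v _ _ h p q p (by lia) hqp, Cochain.single_v] at this
  · exact (mul_eq_zero.mp this).resolve_left (by
      rcases Int.even_or_odd p with hp | hp <;> simp [Int.negOnePow_even, Int.negOnePow_odd, hp])
  · rw [Cochain.comp_v _ _ h i (i + n) i rfl (by lia), Cochain.single_v_eq_zero _ _ _ _ _ hi]
    simp

lemma finiteDimensional_cochain {a b : ℤ}
    (hP : ∀ i, (i < a ∨ b < i) → IsZero (P.X i))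
    (hfin : ∀ i j, FiniteDimensional k (P.X i ⟶ Q.X j)) (n : ℤ) :
    FiniteDimensional k (Cochain P Q n) := by
  let f : Cochain P Q n →ₗ[k] (∀ i : Finset.Icc a b, P.X i ⟶ Q.X (i + n)) :=
    { toFun z i := z.v i (i + n) rfl
      map_add' _ _ := by ext; simp
      map_smul' _ _ := by ext; simp }
  refine FiniteDimensional.of_injective f ((injective_iff_map_eq_zero f).mpr fun z hz ↦ ?_)
  ext p q rfl
  by_cases hp : p ∈ Finset.Icc a b
  · exact congr_fun hz ⟨p, hp⟩
  · exact (hP p (by simp at hp; lia)).eq_of_src _ _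

/-- Duality in the homotopy category from a nondegenerate symmetric family of traces. -/
lemma nonempty_homotopyCategory_hom_equiv_dual [HasZeroObject C] [HasBinaryBiproducts C] {a b : ℤ}
    (hP : ∀ i, (i < a ∨ b < i) → IsZero (P.X i))
    (hfin : ∀ i j, FiniteDimensional k (P.X i ⟶ Q.X j))
    (hτ : ∀ i j (f : P.X i ⟶ P.X j) (g : P.X j ⟶ P.X i), τ i (f ≫ g) = τ j (g ≫ f))
    (hl : ∀ i j (f : P.X i ⟶ Q.X j), f ≠ 0 → ∃ g, τ i (f ≫ g) ≠ 0)
    (hr : ∀ i j (g : Q.X j ⟶ P.X i), g ≠ 0 → ∃ f, τ i (f ≫ g) ≠ 0) (n : ℤ) :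
    Nonempty
      (((HomotopyCategory.quotient C (ComplexShape.up ℤ)).obj P ⟶
          ((HomotopyCategory.quotient C (ComplexShape.up ℤ)).obj Q)⟦n⟧) ≃ₗ[k]
        Module.Dual k
          ((HomotopyCategory.quotient C (ComplexShape.up ℤ)).obj Q ⟶
            ((HomotopyCategory.quotient C (ComplexShape.up ℤ)).obj P)⟦-n⟧)) := by
  obtain ⟨π, hπ, hπ₀⟩ := exists_linear_cocycles_to_homotopyCategory (k := k) P Q (n - 1) n (n + 1)
    (by simp) rfl
  obtain ⟨π', hπ', hπ'₀⟩ := exists_linear_cocycles_to_homotopyCategory (k := k) Q P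
    (-n - 1) (-n) (-n + 1) (by simp) rfl
  have := finiteDimensional_cochain hP hfin n
  have hBY : (tracePairing (Q := Q) τ (Finset.Icc a b) (add_neg_cancel n)).IsPerfPair :=
    .of_injective
      ((injective_iff_map_eq_zero _).mpr fun x hx ↦
        tracePairing_injective τ hP hl _ x fun y ↦ congr($hx y))
      ((injective_iff_map_eq_zero _).mpr fun y hy ↦
        tracePairing_flip_injective τ hP hr _ y fun x ↦ congr($hy x))
  have hsign (m : ℤ) : -((m.negOnePow : ℤ) : k) ≠ 0 := by
    rcases Int.even_or_odd m with hm | hm <;> simp [Int.negOnePow_even, Int.negOnePow_odd, hm]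
  exact nonempty_cohomology_equiv_dual (δ_hom k P Q (n - 1) n) (δ_hom k P Q n (n + 1))
    (δ_hom k Q P (-n - 1) (-n)) (δ_hom k Q P (-n) (-n + 1)) (fun z ↦ δ_δ _ _ _ z)
    (tracePairing τ (Finset.Icc a b) (show n - 1 + (-n + 1) = 0 by lia))
    (tracePairing τ (Finset.Icc a b) (add_neg_cancel n))
    (tracePairing τ (Finset.Icc a b) (show n + 1 + (-n - 1) = 0 by lia))
    (hsign (-n)) (hsign (-n - 1))
    (fun x y ↦ tracePairing_δ τ hτ hP (by lia) rfl _ _ x y)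
    (fun x y ↦ tracePairing_δ τ hτ hP rfl (by lia) _ _ x y)
    (tracePairing_flip_injective τ hP hr _) (tracePairing_injective τ hP hl _)
    π hπ hπ₀ π' hπ' hπ'₀

end Pairing

end CochainComplex.HomComplex

section Trace

open scoped ModuleCat

variable {k : Type u} [Field k] {A : Type u} [Ring A] [Algebra k A] (t : A →ₗ[k] k)

/-- The trace of an endomorphism of a retract of `A ^ m`, with values in `k` via `t`. -/
def retractTrace {M : ModuleCat.{u} A} {m : ℕ} (p : (Fin m → A) →ₗ[A] M)
    (s : M →ₗ[A] Fin m → A) : (M ⟶ M) →ₗ[k] k where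
  toFun f := ∑ j, t (s (f.hom (p (Pi.single j 1))) j)
  map_add' f g := by simp [Finset.sum_add_distrib]
  map_smul' r f := by
    rw [RingHom.id_apply, smul_eq_mul, Finset.mul_sum]
    refine Finset.sum_congr rfl fun j _ ↦ ?_
    rw [ModuleCat.hom_smul, LinearMap.smul_apply, ← algebraMap_smul A r, map_smul, Pi.smul_apply,
      algebraMap_smul, map_smul, smul_eq_mul]

lemma retractTrace_comp {M N : ModuleCat.{u} A} {m n : ℕ} (p : (Fin m → A) →ₗ[A] M)
    (s : M →ₗ[A] Fin m → A) (q : (Fin n → A) →ₗ[A] N) (r : N →ₗ[A] Fin n → A)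
    (hqr : q ∘ₗ r = .id) (f : M ⟶ N) (g : N ⟶ M) :
    retractTrace t p s (f ≫ g) =
      ∑ j, ∑ l, t (r (f.hom (p (Pi.single j 1))) l * s (g.hom (q (Pi.single l 1))) j) := by
  change ∑ j, t (s (g.hom (f.hom (p (Pi.single j 1)))) j) = _
  refine Finset.sum_congr rfl fun j _ ↦ ?_
  refine Eq.trans (congrArg t ?_) (map_sum t _ _)
  let v := r (f.hom (p (Pi.single j 1)))
  let L : (Fin n → A) →ₗ[A] A := LinearMap.proj j ∘ₗ s ∘ₗ g.hom ∘ₗ q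
  calc s (g.hom (f.hom (p (Pi.single j 1)))) j = L v :=
        congrArg (fun x ↦ s (g.hom x) j) (LinearMap.congr_fun hqr (f.hom (p (Pi.single j 1)))).symm
    _ = L (∑ l, v l • Pi.single l 1) := by rw [← pi_eq_sum_univ' v]
    _ = ∑ l, v l * L (Pi.single l 1) := by simp

variable {t}

lemma retractTrace_comp_comm (ht : ∀ x y, t (x * y) = t (y * x))
    {M N : ModuleCat.{u} A} {m n : ℕ} (p : (Fin m → A) →ₗ[A] M)
    (s : M →ₗ[A] Fin m → A) (hps : p ∘ₗ s = .id)
    (q : (Fin n → A) →ₗ[A] N) (r : N →ₗ[A] Fin n → A)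
    (hqr : q ∘ₗ r = .id) (f : M ⟶ N) (g : N ⟶ M) :
    retractTrace t p s (f ≫ g) = retractTrace t q r (g ≫ f) := by
  rw [retractTrace_comp t p s q r hqr, retractTrace_comp t q r p s hps, Finset.sum_comm]
  simp only [ht]

lemma exists_retractTrace_comp_ne_zero (ht : ∀ x y, t (x * y) = t (y * x))
    (ht₀ : ∀ x, x ≠ 0 → ∃ y, t (x * y) ≠ 0)
    {M N : ModuleCat.{u} A} {m n : ℕ} (p : (Fin m → A) →ₗ[A] M)
    (s : M →ₗ[A] Fin m → A) (hps : p ∘ₗ s = .id)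
    (q : (Fin n → A) →ₗ[A] N) (r : N →ₗ[A] Fin n → A)
    (hqr : q ∘ₗ r = .id) (f : M ⟶ N) (hf : f ≠ 0) :
    ∃ g, retractTrace t p s (f ≫ g) ≠ 0 := by
  obtain ⟨j, l, hjl⟩ : ∃ j l, r (f.hom (p (Pi.single j 1))) l ≠ 0 := by
    by_contra! h
    refine hf (ModuleCat.hom_ext ?_)
    have h₁ : r ∘ₗ f.hom ∘ₗ p = 0 := LinearMap.pi_ext' fun j ↦ LinearMap.ext_ring (funext (h j))
    calc f.hom = (q ∘ₗ r) ∘ₗ f.hom ∘ₗ (p ∘ₗ s) := by rw [hps, hqr]; rfl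
      _ = q ∘ₗ (r ∘ₗ f.hom ∘ₗ p) ∘ₗ s := rfl
      _ = 0 := by rw [h₁]; simp
  obtain ⟨y, hy⟩ := ht₀ _ hjl
  let G : (Fin n → A) →ₗ[A] (Fin m → A) :=
    LinearMap.single A (fun _ ↦ A) j ∘ₗ LinearMap.toSpanSingleton A A y ∘ₗ LinearMap.proj l
  let g : ModuleCat.of A (Fin m → A) ⟶ M := ModuleCat.ofHom p
  refine ⟨ModuleCat.ofHom (G ∘ₗ r) ≫ g, ?_⟩
  rw [← Category.assoc, retractTrace_comp_comm ht p s hps (N := ModuleCat.of A (Fin m → A))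
    .id .id rfl]
  change ∑ i, t (Pi.single (M := fun _ ↦ A) j (r (f.hom (p (Pi.single i 1))) l • y) i) ≠ 0
  rw [Finset.sum_eq_single_of_mem j (Finset.mem_univ j) fun i _ hi ↦ by
    rw [Pi.single_eq_of_ne hi, map_zero], Pi.single_eq_same]
  exact hy

/-- Morphisms between finite modules over a finite-dimensional algebra form a finite-dimensional
space. -/
lemma finiteDimensional_moduleCat_hom [FiniteDimensional k A] (M N : ModuleCat.{u} A)
    [Module.Finite A M] [Module.Finite A N] : FiniteDimensional k (M ⟶ N) := by
  have := Module.Finite.trans (R := k) A M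
  have := Module.Finite.trans (R := k) A N
  let f : (M ⟶ N) →ₗ[k] (M →ₗ[k] N) :=
    { toFun g := g.hom.restrictScalars k
      map_add' _ _ := rfl
      map_smul' _ _ := rfl }
  exact FiniteDimensional.of_injective f fun g h hgh ↦
    ModuleCat.hom_ext (LinearMap.ext fun x ↦ LinearMap.congr_fun hgh x)

end Trace

/-- let `A` be a finite-dimensional symmetric algebra over a field `k`, and
let `P`, `Q` be bounded complexes of finitely generated projective `A`-modules.  Then for
every integer `n` there is a `k`-linear isomorphism
`Hom_{K^b(proj A)}(P, Q[n]) ≅ D Hom_{K^b(proj A)}(Q, P[-n])`, where `D = Hom_k(-,k)` and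
the Hom-spaces are the homotopy classes of chain maps. -/
theorem stmt_15 (k : Type u) [Field k] (A : Type u) [Ring A] [Algebra k A]
    [FiniteDimensional k A]
    -- `A` is symmetric: a `k`-linear bijection `φ : A ≃ D(A)` which is a morphism of
    -- `A`-`A`-bimodules, where `(a • f • b) x = f (b * x * a)`.
    (φ : A ≃ₗ[k] (A →ₗ[k] k))
    (hφl : ∀ a x y : A, φ (a * x) y = φ x (y * a))
    (hφr : ∀ x b y : A, φ (x * b) y = φ x (b * y))
    (P Q : CochainComplex (ModuleCat.{u} A) ℤ)
    -- `P` and `Q` are bounded complexes of finitely generated projective modules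
    (hPproj : ∀ i, Projective (P.X i)) (hPfin : ∀ i, Module.Finite A (P.X i))
    (hPbdd : ∃ a b : ℤ, ∀ i, (i < a ∨ b < i) → IsZero (P.X i))
    (hQproj : ∀ i, Projective (Q.X i)) (hQfin : ∀ i, Module.Finite A (Q.X i))
    (hQbdd : ∃ a b : ℤ, ∀ i, (i < a ∨ b < i) → IsZero (Q.X i))
    (n : ℤ) :
    Nonempty
      ((((HomotopyCategory.quotient (ModuleCat.{u} A) (ComplexShape.up ℤ)).obj P ⟶
          ((HomotopyCategory.quotient (ModuleCat.{u} A) (ComplexShape.up ℤ)).obj Q)⟦n⟧)) ≃ₗ[k]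
        Module.Dual k
          ((HomotopyCategory.quotient (ModuleCat.{u} A) (ComplexShape.up ℤ)).obj Q ⟶
            ((HomotopyCategory.quotient (ModuleCat.{u} A) (ComplexShape.up ℤ)).obj P)⟦-n⟧)) := by
  have hφ (x y : A) : φ x y = φ 1 (x * y) := by rw [← hφr, one_mul]
  have ht (x y : A) : φ 1 (x * y) = φ 1 (y * x) := by rw [← hφl, ← hφ, mul_one]
  have ht₀ (x : A) (hx : x ≠ 0) : ∃ y, φ 1 (x * y) ≠ 0 := by
    by_contra! h
    exact hx (φ.map_eq_zero_iff.mp (LinearMap.ext fun y ↦ (hφ x y).trans (h y)))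
  have hproj (M : ModuleCat.{u} A) (hM : Projective M) : Module.Projective A M :=
    (IsProjective.iff_projective M).mpr hM
  have hP (i : ℤ) := have := hproj _ (hPproj i); have := hPfin i
    Module.Finite.exists_comp_eq_id_of_projective A (P.X i)
  have hQ (i : ℤ) := have := hproj _ (hQproj i); have := hQfin i
    Module.Finite.exists_comp_eq_id_of_projective A (Q.X i)
  choose m p s _ _ hps using hP
  choose n' q r _ _ hqr using hQ
  obtain ⟨a, b, hab⟩ := hPbdd
  refine CochainComplex.HomComplex.nonempty_homotopyCategory_hom_equiv_dual
    (fun i ↦ retractTrace (φ 1) (p i) (s i)) hab (fun i j ↦ ?_)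
    (fun i j ↦ retractTrace_comp_comm ht _ _ (hps i) _ _ (hps j))
    (fun i j ↦ exists_retractTrace_comp_ne_zero ht ht₀ _ _ (hps i) _ _ (hqr j))
    (fun i j g hg ↦ ?_) n
  · have := hPfin i
    have := hQfin j
    exact finiteDimensional_moduleCat_hom _ _
  · obtain ⟨f, hf⟩ := exists_retractTrace_comp_ne_zero ht ht₀ _ _ (hqr j) _ _ (hps i) g hg
    exact ⟨f, by rwa [retractTrace_comp_comm ht _ _ (hps i) _ _ (hqr j)]⟩
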